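/- For all integers j ≥ 1, k ≥ 1 and β ≥ 0, one has π(y^{(2k)}_{2β+1,j}) ≥ 2k + β - 1 + ⌊(5j - 5)/2⌋. -/

import Mathlib

open PowerSeries


/-- The Hirschhorn–Hunt matrix `m_{i,j}` (zero outside `1 ≤ j ≤ i`). -/
def mcoef : ℕ → ℕ → ℤ
  | 1, 1 => 5
  | 2, 1 => 2 * 5
  | 2, 2 => 5 ^ 3
  | 3, 1 => 9
  | 3, 2 => 3 * 5 ^ 3
  | 3, 3 => 5 ^ 5
  | 4, 1 => 4
  | 4, 2 => 22 * 5 ^ 2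
  | 4, 3 => 4 * 5 ^ 5
  | 4, 4 => 5 ^ 7
  | 5, 1 => 1
  | 5, 2 => 4 * 5 ^ 3
  | 5, 3 => 8 * 5 ^ 5
  | 5, 4 => 5 ^ 8
  | 5, 5 => 5 ^ 9
  | i + 6, j + 2 =>
      25 * mcoef (i + 5) (j + 1) + 25 * mcoef (i + 4) (j + 1) +
        15 * mcoef (i + 3) (j + 1) + 5 * mcoef (i + 2) (j + 1) + mcoef (i + 1) (j + 1)
  | _, _ => 0

/-- The Hirschhorn–Hunt coefficient vectors: `xcoef k i = x_{k,i}`.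
`x_1 = (5, 0, 0, …)` and `x_{k+1,i} = Σ_{j ≥ 1} x_{k,j} m_{6j,j+i}` for odd `k`,
`x_{k+1,i} = Σ_{j ≥ 1} x_{k,j} m_{6j+1,j+i}` for even `k` (the sums are finitely
supported, and `∑ᶠ` sums over `j + 1` for `j : ℕ`, i.e. over all `j ≥ 1`). -/
noncomputable def xcoef : ℕ → ℕ → ℤ
  | 0, _ => 0
  | 1, j => if j = 1 then 5 else 0
  | k + 2, i =>
      if (k + 1) % 2 = 1 then
        ∑ᶠ j : ℕ, xcoef (k + 1) (j + 1) * mcoef (6 * (j + 1)) ((j + 1) + i)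
      else
        ∑ᶠ j : ℕ, xcoef (k + 1) (j + 1) * mcoef (6 * (j + 1) + 1) ((j + 1) + i)

/-- `yeven k β j = y^{(2k)}_{β,j}`: `y^{(2k)}_{1,j} = x_{2k-1,j}` and
`y^{(2k)}_{β+1,j} = Σ_{i ≥ 1} y^{(2k)}_{β,i} m_{6i,j+i}` for odd `β`,
`y^{(2k)}_{β+1,j} = Σ_{i ≥ 1} y^{(2k)}_{β,i} m_{6i+2,j+i}` for even `β`. -/
noncomputable def yeven (k : ℕ) : ℕ → ℕ → ℤ
  | 0, _ => 0
  | 1, j => xcoef (2 * k - 1) j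
  | β + 2, j =>
      if (β + 1) % 2 = 1 then
        ∑ᶠ i : ℕ, yeven k (β + 1) (i + 1) * mcoef (6 * (i + 1)) (j + (i + 1))
      else
        ∑ᶠ i : ℕ, yeven k (β + 1) (i + 1) * mcoef (6 * (i + 1) + 2) (j + (i + 1))

/-- The bound `π(m_{i,j}) ≥ ⌊(5j - i - 1)/2⌋` as a divisibility. -/
theorem five_pow_dvd_mcoef (i j : ℕ) : (5 : ℤ) ^ ((5 * j - i - 1) / 2) ∣ mcoef i j := by
  fun_induction mcoef i j with
  | case16 i j h₅ h₄ h₃ h₂ h₁ =>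
    have scale : ∀ {a b : ℕ} (c : ℕ) (u : ℤ) {n : ℤ}, (5 : ℤ) ^ b ∣ n → a ≤ c + b →
        (5 : ℤ) ^ a ∣ 5 ^ c * u * n := by
      intro a b c u n hn hab
      refine (pow_dvd_pow 5 hab).trans ?_
      rw [pow_add]
      exact mul_dvd_mul (dvd_mul_right _ _) hn
    have e₅ := scale (a := (5 * (j + 2) - (i + 6) - 1) / 2) 2 1 h₅ (by omega)
    have e₄ := scale (a := (5 * (j + 2) - (i + 6) - 1) / 2) 2 1 h₄ (by omega)
    have e₃ := scale (a := (5 * (j + 2) - (i + 6) - 1) / 2) 1 3 h₃ (by omega)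
    have e₂ := scale (a := (5 * (j + 2) - (i + 6) - 1) / 2) 1 1 h₂ (by omega)
    have e₁ := scale (a := (5 * (j + 2) - (i + 6) - 1) / 2) 0 1 h₁ (by omega)
    norm_num at e₅ e₄ e₃ e₂ e₁
    exact dvd_add (dvd_add (dvd_add (dvd_add e₅ e₄) e₃) e₂) e₁
  | _ => norm_num

theorem dvd_finsum {ι R : Type*} [CommSemiring R] {d : R} {f : ι → R} (h : ∀ i, d ∣ f i) :
    d ∣ ∑ᶠ i, f i :=
  finsum_induction (d ∣ ·) (dvd_zero d) (fun _ _ => dvd_add) h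

/-- Transfer of divisibility through one step of the recurrences: `v` is a vector whose `i`-th
entry is divisible by `5 ^ a i`, paired with the entries `m_{6i+c, j+i}`. -/
theorem five_pow_dvd_finsum_mul_mcoef {v : ℕ → ℤ} {a : ℕ → ℕ} (c j e : ℕ)
    (hv : ∀ i, 1 ≤ i → (5 : ℤ) ^ a i ∣ v i)
    (he : ∀ i, 1 ≤ i → e ≤ a i + (5 * (j + i) - (6 * i + c) - 1) / 2) :
    (5 : ℤ) ^ e ∣ ∑ᶠ i : ℕ, v (i + 1) * mcoef (6 * (i + 1) + c) (j + (i + 1)) := by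
  refine dvd_finsum fun i => (pow_dvd_pow 5 (he (i + 1) (by omega))).trans ?_
  rw [pow_add]
  exact mul_dvd_mul (hv _ (by omega)) (five_pow_dvd_mcoef _ _)

/-- The bound `π(x_{2k-1,j}) ≥ 2k - 1 + ⌊(5j - 5)/2⌋` as a divisibility, with `k` shifted by one. -/
theorem five_pow_dvd_xcoef_odd (k : ℕ) :
    ∀ j, 1 ≤ j → (5 : ℤ) ^ (2 * k + 1 + (5 * j - 5) / 2) ∣ xcoef (2 * k + 1) j := by
  induction k with
  | zero =>
    intro j hj
    rw [Nat.mul_zero, Nat.zero_add, xcoef]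
    split_ifs with h
    · subst h; norm_num
    · exact dvd_zero _
  | succ k ih =>
    have even : ∀ j, 1 ≤ j →
        (5 : ℤ) ^ (2 * k + 1 + (5 * j - 2) / 2) ∣ xcoef (2 * k + 2) j := by
      intro j hj
      rw [xcoef, if_pos (by omega)]
      simp only [Nat.add_comm _ j]
      exact five_pow_dvd_finsum_mul_mcoef 0 j _ ih fun i hi => by
        obtain rfl | hi := hi.eq_or_lt <;> omega
    intro j hj
    rw [show 2 * (k + 1) + 1 = 2 * k + 1 + 2 by ring, xcoef, if_neg (by omega)]
    simp only [Nat.add_comm _ j]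
    exact five_pow_dvd_finsum_mul_mcoef 1 j _ even fun i hi => by omega

theorem five_pow_dvd_yeven_odd (k : ℕ) (hk : 1 ≤ k) (β : ℕ) :
    ∀ j, 1 ≤ j → (5 : ℤ) ^ (2 * k + β - 1 + (5 * j - 5) / 2) ∣ yeven k (2 * β + 1) j := by
  induction β with
  | zero =>
    intro j hj
    obtain ⟨k, rfl⟩ := Nat.exists_eq_add_of_le' hk
    rw [Nat.mul_zero, Nat.zero_add, yeven]
    exact five_pow_dvd_xcoef_odd k j hj
  | succ β ih =>
    have even : ∀ j, 1 ≤ j →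
        (5 : ℤ) ^ (2 * k + β - 1 + (5 * j - 2) / 2) ∣ yeven k (2 * β + 2) j := by
      intro j hj
      rw [yeven, if_pos (by omega)]
      exact five_pow_dvd_finsum_mul_mcoef 0 j _ ih fun i hi => by
        obtain rfl | hi := hi.eq_or_lt <;> omega
    intro j hj
    rw [show 2 * (β + 1) + 1 = 2 * β + 1 + 2 by ring, yeven, if_neg (by omega)]
    exact five_pow_dvd_finsum_mul_mcoef 2 j _ even fun i hi => by omega

/-- Lemma 4.4, Eq. (4.3): `π(y^{(2k)}_{2β+1,j}) ≥ 2k + β - 1 + ⌊(5j-5)/2⌋` where `π`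
is the 5-adic valuation (with `π(0) = +∞`). -/
theorem val_yeven_a (j k β : ℕ) (hj : 1 ≤ j) (hk : 1 ≤ k) :
    ((2 * k + β - 1 + (5 * j - 5) / 2 : ℕ) : ℕ∞) ≤
      emultiplicity (5 : ℤ) (yeven k (2 * β + 1) j) := by
  exact le_emultiplicity_of_pow_dvd (five_pow_dvd_yeven_odd k hk β j hj)
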